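/- arXiv:2305.02213 — 2 statements merged into one kernel-verified Lean document; each statement's English description precedes it below -/
import Mathlib

section
/- Let K : ℝ₊ × ℝ₊ → ℝ be a continuous positive definite kernel (i.e., for every n and every choice of points x₁,…,xₙ ∈ ℝ₊ the matrix with entries K(xᵢ,xⱼ) is positive semidefinite) such that the set of t for which the section K(t,·) is not absolutely integrable has Lebesgue measure zero. Then sup_{u ∈ B∞} ∫₀^∞ |∫₀^∞ K(t,τ)u(τ)dτ| dt = sup_{u ∈ U∞} ∫₀^∞ |∫₀^∞ K(t,τ)u(τ)dτ| dt, as an equality in [0,∞]. Consequently, the RKHS induced by K is BIBO stable if and only if sup_{u ∈ U∞} ‖L_K[u]‖₁ < ∞. -/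
open MeasureTheory Set ENNReal Filter

/-- `ℝ₊ = [0,∞)` with Lebesgue measure. -/
noncomputable def posVol : Measure ℝ := volume.restrict (Set.Ici 0)

/-- `U∞`: measurable functions on `ℝ₊` with `|u t| = 1` almost everywhere. -/
def memU (u : ℝ → ℝ) : Prop := Measurable u ∧ ∀ᵐ t ∂posVol, |u t| = 1

/-- `B∞`: measurable functions on `ℝ₊` with essential supremum norm equal to `1`. -/
def memB (u : ℝ → ℝ) : Prop := Measurable u ∧ eLpNorm u ⊤ posVol = 1

/-- The kernel operator `L_K[u](t) = ∫₀^∞ K(t,τ)u(τ)dτ`. -/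
noncomputable def LK (K : ℝ → ℝ → ℝ) (u : ℝ → ℝ) (t : ℝ) : ℝ :=
  ∫ τ in Set.Ici (0:ℝ), K t τ * u τ

/-- The (possibly infinite) `L¹` norm `‖y‖₁ = ∫₀^∞ |y(t)| dt`. -/
noncomputable def norm1 (y : ℝ → ℝ) : ℝ≥0∞ :=
  ∫⁻ t in Set.Ici (0:ℝ), ENNReal.ofReal |y t|

/-- The sign function of `u` relative to the level `2θ - 1`. -/
noncomputable def levelSign (u : ℝ → ℝ) (θ t : ℝ) : ℝ := if θ ≤ (1 + u t) / 2 then 1 else -1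

theorem abs_levelSign (u : ℝ → ℝ) (θ t : ℝ) : |levelSign u θ t| = 1 := by
  unfold levelSign
  split_ifs <;> simp

theorem measurable_levelSign {u : ℝ → ℝ} (hu : Measurable u) :
    Measurable fun p : ℝ × ℝ => levelSign u p.1 p.2 :=
  Measurable.ite (measurableSet_le measurable_fst (by fun_prop)) measurable_const measurable_const

theorem memU_levelSign {u : ℝ → ℝ} (hu : Measurable u) (θ : ℝ) : memU (levelSign u θ) :=
  ⟨(measurable_levelSign hu).comp measurable_prodMk_left, ae_of_all _ (abs_levelSign u θ)⟩

/-- A function bounded by `1` is the average of its level signs. -/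
theorem integral_levelSign {u : ℝ → ℝ} {t : ℝ} (ht : |u t| ≤ 1) :
    ∫ θ in Icc (0:ℝ) 1, levelSign u θ t = u t := by
  obtain ⟨h₁, h₂⟩ := abs_le.mp ht
  have hs : ∀ θ, levelSign u θ t = 2 * (Iic ((1 + u t) / 2)).indicator (fun _ => (1:ℝ)) θ - 1 := by
    intro θ
    by_cases h : θ ≤ (1 + u t) / 2
    · simp only [levelSign, indicator, mem_Iic, if_pos h]; norm_num
    · simp only [levelSign, indicator, mem_Iic, if_neg h]; norm_num
  have hset : Icc (0:ℝ) 1 ∩ Iic ((1 + u t) / 2) = Icc 0 ((1 + u t) / 2) := by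
    ext x
    simp only [mem_inter_iff, mem_Icc, mem_Iic]
    constructor
    · rintro ⟨⟨a, _⟩, c⟩; exact ⟨a, c⟩
    · rintro ⟨a, c⟩; exact ⟨⟨a, by linarith⟩, c⟩
  simp_rw [hs]
  rw [integral_sub, integral_const_mul, setIntegral_indicator measurableSet_Iic, hset]
  · simp only [integral_const, smul_eq_mul, mul_one, measureReal_restrict_apply_univ,
      Real.volume_real_Icc]
    rw [max_eq_left (by linarith), max_eq_left (by norm_num)]
    ring
  · exact ((integrable_const (1:ℝ)).indicator measurableSet_Iic).const_mul 2
  · exact integrable_const 1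

theorem memU.memB {u : ℝ → ℝ} (hu : memU u) : memB u := by
  refine ⟨hu.1, ?_⟩
  have h0 : posVol ≠ 0 := by
    simp [posVol, Measure.restrict_eq_zero]
  rw [eLpNorm_congr_norm_ae (g := fun _ => (1:ℝ)) (by filter_upwards [hu.2] with t ht; simpa using ht),
    eLpNorm_const (1:ℝ) (by simp) h0]
  simp

theorem memB.ae_abs_le {u : ℝ → ℝ} (hu : memB u) : ∀ᵐ t ∂posVol, |u t| ≤ 1 := by
  have h := hu.2
  rw [eLpNorm_exponent_top] at h
  filter_upwards [ae_le_eLpNormEssSup (f := u) (μ := posVol)] with t ht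
  rw [h, Real.enorm_eq_ofReal_abs] at ht
  simpa using ht

/-- Fubini: `L_K[u]` is the average of the `L_K` of the level signs of `u`. -/
theorem LK_eq_integral_levelSign {K : ℝ → ℝ → ℝ} {u : ℝ → ℝ} (hu : memB u) {t : ℝ}
    (ht : IntegrableOn (fun τ => K t τ) (Ici 0)) :
    LK K u t = ∫ θ in Icc (0:ℝ) 1, LK K (levelSign u θ) t := by
  unfold LK
  rw [integral_integral_swap]
  · refine integral_congr_ae ?_
    filter_upwards [hu.ae_abs_le] with τ hτ
    rw [integral_const_mul, integral_levelSign hτ]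
  · have hK : Integrable (fun p : ℝ × ℝ => K t p.2)
        ((volume.restrict (Icc (0:ℝ) 1)).prod (volume.restrict (Ici (0:ℝ)))) :=
      Integrable.comp_snd ht _
    exact hK.mul_bdd (c := 1) (measurable_levelSign hu.1).aestronglyMeasurable
      (ae_of_all _ fun p => by simp [abs_levelSign])

theorem norm1_LK_le_lintegral_levelSign {K : ℝ → ℝ → ℝ}
    (hK : Measurable fun p : ℝ × ℝ => K p.1 p.2)
    (hsec : ∀ᵐ t ∂posVol, IntegrableOn (fun τ => K t τ) (Ici 0)) {u : ℝ → ℝ} (hu : memB u) :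
    norm1 (LK K u) ≤ ∫⁻ θ in Icc (0:ℝ) 1, norm1 (LK K (levelSign u θ)) := by
  have hm : Measurable fun p : ℝ × ℝ => LK K (levelSign u p.2) p.1 := by
    have h : Measurable fun q : (ℝ × ℝ) × ℝ => K q.1.1 q.2 * levelSign u q.1.2 q.2 :=
      (hK.comp (measurable_fst.fst.prodMk measurable_snd)).mul
        ((measurable_levelSign hu.1).comp (measurable_fst.snd.prodMk measurable_snd))
    exact h.stronglyMeasurable.integral_prod_right.measurable
  unfold norm1
  rw [← lintegral_lintegral_swap hm.norm.ennreal_ofReal.aemeasurable]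
  refine lintegral_mono_ae ?_
  filter_upwards [hsec] with t ht
  rw [LK_eq_integral_levelSign hu ht]
  simp_rw [← Real.enorm_eq_ofReal_abs]
  exact enorm_integral_le_lintegral_enorm _

/-- For a continuous positive definite kernel `K` on `ℝ₊ × ℝ₊` whose sections
`K(t,·)` are absolutely integrable for a.e. `t`, the supremum of `‖L_K[u]‖₁` over
`B∞` equals the supremum over `U∞`; consequently, the RKHS induced by `K` is BIBO
stable (i.e. `sup_{u ∈ B∞} ‖L_K[u]‖₁ < ∞`) iff `sup_{u ∈ U∞} ‖L_K[u]‖₁ < ∞`. -/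
theorem stmt1 (K : ℝ → ℝ → ℝ)
    (hcont : Continuous fun p : ℝ × ℝ => K p.1 p.2)
    (hpd : ∀ (n : ℕ) (x : Fin n → ℝ), (∀ i, 0 ≤ x i) →
      (Matrix.of fun i j : Fin n => K (x i) (x j)).PosSemidef)
    (hsec : volume {t : ℝ | 0 ≤ t ∧
      ¬ MeasureTheory.IntegrableOn (fun τ => K t τ) (Set.Ici 0)} = 0) :
    ((⨆ (u : ℝ → ℝ) (_ : memB u), norm1 (LK K u))
      = ⨆ (u : ℝ → ℝ) (_ : memU u), norm1 (LK K u)) ∧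
    ((⨆ (u : ℝ → ℝ) (_ : memB u), norm1 (LK K u)) < ⊤ ↔
      (⨆ (u : ℝ → ℝ) (_ : memU u), norm1 (LK K u)) < ⊤) := by
  have hae : ∀ᵐ t ∂posVol, IntegrableOn (fun τ => K t τ) (Ici 0) := by
    rw [posVol, ae_restrict_iff' measurableSet_Ici, ae_iff]
    simpa only [mem_Ici, Classical.not_imp] using hsec
  have heq : (⨆ (u : ℝ → ℝ) (_ : memB u), norm1 (LK K u))
      = ⨆ (u : ℝ → ℝ) (_ : memU u), norm1 (LK K u) := by
    refine le_antisymm (iSup₂_le fun u hu => ?_)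
      (iSup₂_le fun u hu => le_iSup₂ (f := fun u (_ : memB u) => norm1 (LK K u)) u hu.memB)
    calc norm1 (LK K u)
        ≤ ∫⁻ θ in Icc (0:ℝ) 1, norm1 (LK K (levelSign u θ)) :=
          norm1_LK_le_lintegral_levelSign hcont.measurable hae hu
      _ ≤ ∫⁻ _ in Icc (0:ℝ) 1, ⨆ (u : ℝ → ℝ) (_ : memU u), norm1 (LK K u) :=
          lintegral_mono fun θ => le_iSup₂ (f := fun u (_ : memU u) => norm1 (LK K u))
            (levelSign u θ) (memU_levelSign hu.1 θ)
      _ = ⨆ (u : ℝ → ℝ) (_ : memU u), norm1 (LK K u) := by simp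
  exact ⟨heq, by rw [heq]⟩
end

section
/- Let K : ℝ₊ × ℝ₊ → ℝ be a measurable stable kernel, i.e., ‖K‖_{∞,1} := sup_{u ∈ B∞} ‖L_K[u]‖₁ < ∞. Then for any u ∈ B∞ such that |u(t)| ≥ 1/2 for every t ∈ ℝ₊, and for any ε > 0, there exists v ∈ U∞ such that ‖L_K[v]‖₁ ≥ ‖L_K[u]‖₁ − ε. -/
open MeasureTheory Set ENNReal Filter

/-- The two-valued function equal to `1` where `2 * s - 1 ≤ u` and to `-1` elsewhere. -/
noncomputable def thresholdSign (u : ℝ → ℝ) (s τ : ℝ) : ℝ :=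
  if s ≤ (u τ + 1) / 2 then 1 else -1

theorem abs_thresholdSign (u : ℝ → ℝ) (s τ : ℝ) : |thresholdSign u s τ| = 1 := by
  unfold thresholdSign
  split_ifs <;> simp

theorem measurable_thresholdSign {u : ℝ → ℝ} (hu : Measurable u) :
    Measurable fun p : ℝ × ℝ => thresholdSign u p.1 p.2 := by
  unfold thresholdSign
  exact Measurable.ite (measurableSet_le measurable_fst (by fun_prop)) measurable_const
    measurable_const

theorem memU_thresholdSign {u : ℝ → ℝ} (hu : Measurable u) (s : ℝ) :
    memU (thresholdSign u s) :=
  ⟨(measurable_thresholdSign hu).comp (measurable_const.prodMk measurable_id),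
    ae_of_all _ (abs_thresholdSign u s)⟩

/-- A function with values in `[-1, 1]` is the average of its threshold signs. -/
theorem integral_thresholdSign {u : ℝ → ℝ} {τ : ℝ} (h : |u τ| ≤ 1) :
    ∫ s in Icc (0 : ℝ) 1, thresholdSign u s τ = u τ := by
  obtain ⟨h1, h2⟩ := abs_le.1 h
  have hsplit : (fun s => thresholdSign u s τ) =
      fun s => (Iic ((u τ + 1) / 2)).indicator (fun _ => (2 : ℝ)) s - 1 := by
    funext s
    by_cases hs : s ≤ (u τ + 1) / 2
    · simp only [thresholdSign, hs, if_true, indicator, mem_Iic]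
      norm_num
    · simp [thresholdSign, hs, indicator]
  have hinter : Icc (0 : ℝ) 1 ∩ Iic ((u τ + 1) / 2) = Icc 0 ((u τ + 1) / 2) := by
    ext s
    simp only [mem_inter_iff, mem_Icc, mem_Iic]
    constructor
    · rintro ⟨⟨h0, -⟩, h⟩
      exact ⟨h0, h⟩
    · rintro ⟨h0, h⟩
      exact ⟨⟨h0, by linarith⟩, h⟩
  rw [hsplit, integral_sub ((integrable_const _).indicator measurableSet_Iic)
    (integrable_const _), setIntegral_indicator measurableSet_Iic, hinter]
  simp only [setIntegral_const, Real.volume_real_Icc, smul_eq_mul]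
  rw [max_eq_left (by linarith), max_eq_left (by norm_num)]
  ring

theorem memB.ae_abs_le_one {u : ℝ → ℝ} (hu : memB u) : ∀ᵐ τ ∂posVol, |u τ| ≤ 1 := by
  have h := hu.2
  rw [eLpNorm_exponent_top] at h
  filter_upwards [ae_le_eLpNormEssSup (f := u) (μ := posVol)] with τ hτ
  rw [h, Real.enorm_eq_ofReal_abs] at hτ
  exact ENNReal.ofReal_le_one.1 hτ

theorem LK_eq_integral_thresholdSign {K : ℝ → ℝ → ℝ} {u : ℝ → ℝ} (hu : memB u) {t : ℝ}
    (hint : Integrable (K t) posVol) :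
    LK K u t = ∫ s in Icc (0 : ℝ) 1, LK K (thresholdSign u s) t := by
  have hprod : Integrable (fun p : ℝ × ℝ => K t p.2 * thresholdSign u p.1 p.2)
      ((volume.restrict (Icc (0 : ℝ) 1)).prod posVol) := by
    have : SFinite posVol := by unfold posVol; infer_instance
    refine (hint.comp_snd (volume.restrict (Icc (0 : ℝ) 1))).mul_bdd (c := 1)
      (measurable_thresholdSign hu.1).aestronglyMeasurable (ae_of_all _ fun p => ?_)
    rw [Real.norm_eq_abs, abs_thresholdSign]
  unfold LK
  rw [integral_integral_swap hprod]
  refine integral_congr_ae ?_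
  filter_upwards [hu.ae_abs_le_one] with τ hτ
  rw [integral_const_mul, integral_thresholdSign hτ]

theorem LK_eq_zero_of_not_integrable {K : ℝ → ℝ → ℝ}
    (hK : Measurable fun p : ℝ × ℝ => K p.1 p.2) {u : ℝ → ℝ}
    (hhalf : ∀ t : ℝ, 0 ≤ t → (1 : ℝ) / 2 ≤ |u t|) {t : ℝ}
    (hint : ¬ Integrable (K t) posVol) : LK K u t = 0 := by
  refine integral_undef fun h => hint ?_
  refine (h.const_mul 2).mono (hK.comp (measurable_const.prodMk measurable_id)).aestronglyMeasurable
    ?_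
  filter_upwards [ae_restrict_mem measurableSet_Ici] with τ hτ
  have := hhalf τ hτ
  simp only [norm_mul, Real.norm_eq_abs, abs_two]
  nlinarith [abs_nonneg (K t τ)]

theorem measurable_LK_thresholdSign {K : ℝ → ℝ → ℝ}
    (hK : Measurable fun p : ℝ × ℝ => K p.1 p.2) {u : ℝ → ℝ} (hu : Measurable u) :
    Measurable fun p : ℝ × ℝ => LK K (thresholdSign u p.2) p.1 := by
  have h : Measurable fun q : (ℝ × ℝ) × ℝ => K q.1.1 q.2 * thresholdSign u q.1.2 q.2 :=
    (hK.comp ((measurable_fst.comp measurable_fst).prodMk measurable_snd)).mul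
      ((measurable_thresholdSign hu).comp
        ((measurable_snd.comp measurable_fst).prodMk measurable_snd))
  exact (h.stronglyMeasurable.integral_prod_right (ν := volume.restrict (Ici (0 : ℝ)))).measurable

theorem norm1_LK_le_lintegral {K : ℝ → ℝ → ℝ}
    (hK : Measurable fun p : ℝ × ℝ => K p.1 p.2) {u : ℝ → ℝ} (hu : memB u)
    (hhalf : ∀ t : ℝ, 0 ≤ t → (1 : ℝ) / 2 ≤ |u t|) :
    norm1 (LK K u) ≤ ∫⁻ s in Icc (0 : ℝ) 1, norm1 (LK K (thresholdSign u s)) := by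
  have hmeas : Measurable fun p : ℝ × ℝ =>
      ENNReal.ofReal |LK K (thresholdSign u p.2) p.1| := by
    have := measurable_LK_thresholdSign hK hu.1
    simp only [← Real.norm_eq_abs]
    exact this.norm.ennreal_ofReal
  unfold norm1
  rw [← lintegral_lintegral_swap hmeas.aemeasurable]
  refine lintegral_mono fun t => ?_
  by_cases hint : Integrable (K t) posVol
  · rw [LK_eq_integral_thresholdSign hu hint]
    simp only [← Real.enorm_eq_ofReal_abs]
    exact enorm_integral_le_lintegral_enorm _
  · simp [LK_eq_zero_of_not_integrable hK hhalf hint]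

/-- For a measurable stable kernel `K`, any `u ∈ B∞` with `|u t| ≥ 1/2` for every
`t ∈ ℝ₊`, and any `ε > 0`, there exists `v ∈ U∞` with `‖L_K[v]‖₁ ≥ ‖L_K[u]‖₁ − ε`. -/
theorem stmt7 (K : ℝ → ℝ → ℝ)
    (hK : Measurable fun p : ℝ × ℝ => K p.1 p.2)
    (hstable : (⨆ (u : ℝ → ℝ) (_ : memB u), norm1 (LK K u)) < ⊤)
    (u : ℝ → ℝ) (hu : memB u) (hhalf : ∀ t : ℝ, 0 ≤ t → (1:ℝ)/2 ≤ |u t|)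
    (ε : ℝ) (hε : 0 < ε) :
    ∃ v : ℝ → ℝ, memU v ∧
      norm1 (LK K v) ≥ norm1 (LK K u) - ENNReal.ofReal ε := by
  have hfin : norm1 (LK K u) ≠ ⊤ :=
    ((le_iSup₂ (f := fun (w : ℝ → ℝ) (_ : memB w) => norm1 (LK K w)) u hu).trans_lt hstable).ne
  by_contra! hlt
  have hs (s : ℝ) := hlt _ (memU_thresholdSign hu.1 s)
  have hle : norm1 (LK K u) ≤ norm1 (LK K u) - ENNReal.ofReal ε := by
    refine (norm1_LK_le_lintegral hK hu hhalf).trans ((lintegral_mono fun s => (hs s).le).trans ?_)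
    simp
  have hpos : norm1 (LK K u) ≠ 0 := fun h0 => by
    simpa [h0] using hs 0
  exact hle.not_gt (ENNReal.sub_lt_self hfin hpos (ENNReal.ofReal_pos.2 hε).ne')
end
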